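/- arXiv:0810.5600 — 2 statements merged into one kernel-verified Lean document; each statement's English description precedes it below -/
import Mathlib

section
/- Let X be a separable real Banach space that admits a separating polynomial, let G ⊆ X be a bounded open set, and let F : G → ℝ be bounded and uniformly continuous. Then for each ε > 0 there exists a function K : G → ℝ which is real analytic on G, Lipschitz on G, and satisfies |F(x) − K(x)| < ε for all x ∈ G. -/
open scoped NNReal

/-- A (continuous) polynomial on a real Banach space `X`: a finite sum
`x ↦ ∑_{i=0}^n P_i(x,…,x)` where each `P_i` is a continuous `i`-linear form. -/
def IsPolynomialFun {X : Type*} [NormedAddCommGroup X] [NormedSpace ℝ X] (f : X → ℝ) : Prop :=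
  ∃ (n : ℕ) (P : (i : ℕ) → ContinuousMultilinearMap ℝ (fun _ : Fin i => X) ℝ),
    ∀ x, f x = ∑ i ∈ Finset.range (n + 1), P i (fun _ => x)

/-- A separating polynomial on `X`: a polynomial `q` with `q 0 = 0 < inf {|q x| : ‖x‖ = 1}`. -/
def IsSeparatingPolynomial {X : Type*} [NormedAddCommGroup X] [NormedSpace ℝ X]
    (q : X → ℝ) : Prop :=
  IsPolynomialFun q ∧ q 0 = 0 ∧ ∃ η > (0 : ℝ), ∀ x : X, ‖x‖ = 1 → η ≤ |q x|


section partC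
open Metric Topology Filter

theorem cauchy_iter {E F : Type*} [NormedAddCommGroup E] [NormedSpace ℂ E]
    [NormedAddCommGroup F] [NormedSpace ℂ F] [CompleteSpace F] {f : E → F} {c : E} {R M δ : ℝ}
    (hf : AnalyticOnNhd ℂ f (ball c R)) (hM : ∀ y ∈ ball c R, ‖f y‖ ≤ M) (hδ : 0 < δ) (n : ℕ) :
    ∀ y ∈ ball c (R - n * δ), ‖iteratedFDeriv ℂ n f y‖ ≤ M * (2 / δ) ^ n := by
  induction n with
  | zero => intro y hy; simpa using hM y (by simpa using hy)
  | succ n ih =>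
    intro y hy
    have hsub : ball y δ ⊆ ball c (R - n * δ) := by
      apply ball_subset_ball'
      rw [mem_ball] at hy
      push_cast at hy
      linarith
    have hsub' : ball c (R - n * δ) ⊆ ball c R := ball_subset_ball (by nlinarith [n.cast_nonneg (α := ℝ)])
    rw [← norm_fderiv_iteratedFDeriv]
    have h1 : DifferentiableOn ℂ (iteratedFDeriv ℂ n f) (ball y δ) :=
      ((hf.iteratedFDeriv n).mono (hsub.trans hsub')).differentiableOn
    have h2 := Complex.norm_fderiv_le_div_of_mapsTo_ball (R₂ := 2 * (M * (2 / δ) ^ n)) h1 ?_ hδ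
    · refine h2.trans (le_of_eq ?_)
      rw [pow_succ]; ring
    · intro z hz
      rw [mem_closedBall, dist_eq_norm]
      refine (norm_sub_le _ _).trans ?_
      have := ih z (hsub hz)
      have := ih y (hsub (mem_ball_self hδ))
      linarith

theorem fps_of_bound {E : Type*} [NormedAddCommGroup E] [NormedSpace ℂ E]
    {f : E → ℂ} {c : E} {R M : ℝ} (hR : 0 < R)
    (hf : AnalyticOnNhd ℂ f (ball c R)) (hM : ∀ y ∈ ball c R, ‖f y‖ ≤ M) :
    ∃ q : FormalMultilinearSeries ℂ E ℂ, (∀ n, ‖q n‖ * (R / 12) ^ n ≤ 3 * M * (1/2) ^ n) ∧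
      ∀ y, ‖y‖ < R / 12 → HasSum (fun n => q n (fun _ => y)) (f (c + y)) := by
  have hM0 : 0 ≤ M := (norm_nonneg _).trans (hM c (mem_ball_self hR))
  let q : FormalMultilinearSeries ℂ E ℂ := fun n => ((n.factorial : ℂ)⁻¹) • iteratedFDeriv ℂ n f c
  have hq : ∀ n, ‖q n‖ * (R / 12) ^ n ≤ 3 * M * (1/2) ^ n := by
    intro n
    have h1 := cauchy_iter hf hM (δ := R / (n + 1)) (by positivity) n c (by
      apply mem_ball_self
      have : (0:ℝ) < n + 1 := by positivity
      have : R - n * (R / (n+1)) = R / (n+1) := by field_simp; ring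
      rw [this]; positivity)
    have h2 := Real.pow_div_factorial_le_exp (x := (n + 1 : ℝ)) (by positivity) n
    have h3 : Real.exp (n + 1) ≤ 3 ^ (n + 1) := by
      have : Real.exp (n + 1) = (Real.exp 1) ^ (n + 1) := by
        rw [← Real.exp_nat_mul]; push_cast; ring_nf
      rw [this]
      exact pow_le_pow_left₀ (Real.exp_pos _).le (by linarith [Real.exp_one_lt_d9]) _
    have h4 : ‖q n‖ = (n.factorial : ℝ)⁻¹ * ‖iteratedFDeriv ℂ n f c‖ := by
      simp only [q, norm_smul, norm_inv, Complex.norm_natCast]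
    rw [h4]
    calc _ ≤ (n.factorial : ℝ)⁻¹ * (M * (2 / (R / (n + 1))) ^ n) * (R/12) ^ n := by gcongr
      _ = M * (((n:ℝ) + 1) ^ n / n.factorial) * (1/6) ^ n := by
          have : (2 / (R / ((n:ℝ) + 1))) ^ n * (R / 12) ^ n = ((n:ℝ) + 1) ^ n * (1/6) ^ n := by
            rw [← mul_pow, ← mul_pow]; congr 1; field_simp; norm_num
          rw [mul_assoc, mul_assoc, this]; ring
      _ ≤ M * 3 ^ (n + 1) * (1/6) ^ n := by gcongr; exact h2.trans h3
      _ = 3 * M * (1/2) ^ n := by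
          have : (1/2 : ℝ) ^ n = 3 ^ n * (1/6) ^ n := by rw [← mul_pow]; norm_num
          rw [this, pow_succ]; ring
  refine ⟨q, hq, ?_⟩
  have hrad : ENNReal.ofReal (R / 12) ≤ q.radius := by
    have := q.le_radius_of_bound (r := Real.toNNReal (R/12)) (3 * M) (fun n => by
      rw [Real.coe_toNNReal _ (by positivity)]
      refine (hq n).trans ?_
      have : (1/2 : ℝ) ^ n ≤ 1 := pow_le_one₀ (by norm_num) (by norm_num)
      nlinarith)
    exact this
  have hR' : 0 < ENNReal.ofReal (R / 12) := by simp; positivity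
  have hfq : HasFPowerSeriesOnBall q.sum q 0 (ENNReal.ofReal (R/12)) :=
    (q.hasFPowerSeriesOnBall (hR'.trans_le hrad)).mono hR' hrad
  obtain ⟨p, r, hp⟩ := hf c (mem_ball_self hR)
  have hpq : ∀ n y, p n (fun _ => y) = q n (fun _ => y) := by
    intro n y
    have := hp.iteratedFDeriv_eq_sum_of_completeSpace (n := n) (fun _ => y)
    simp only [q, smul_apply, this]
    simp [Finset.card_univ, Fintype.card_perm]
    rw [← mul_assoc, inv_mul_cancel₀ (by exact_mod_cast n.factorial_ne_zero), one_mul]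
  have heq : Set.EqOn (fun y => f (c + y)) q.sum (ball 0 (R/12)) := by
    refine AnalyticOnNhd.eqOn_of_preconnected_of_eventuallyEq (𝕜 := ℂ) (z₀ := 0) ?_ ?_ (convex_ball _ _).isPreconnected
      (mem_ball_self (by positivity)) ?_
    · intro y hy
      have : AnalyticAt ℂ f (c + y) := hf _ (by
        rw [mem_ball, dist_eq_norm] at hy ⊢; simp at hy ⊢; linarith)
      exact this.fun_comp (by fun_prop)
    · intro y hy
      apply hfq.analyticAt_of_mem
      simpa [Metric.eball_ofReal] using hy
    · have := hp.r_pos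
      have h : ∀ᶠ y in nhds (0:E), y ∈ Metric.eball (0:E) r := Metric.eball_mem_nhds _ this
      filter_upwards [h] with y hy
      have := (hp.hasSum hy).tsum_eq
      rw [← this, FormalMultilinearSeries.sum]
      simp_rw [hpq]
  intro y hy
  have hyb : y ∈ ball (0:E) (R/12) := by simpa using hy
  have := hfq.hasSum (y := y) (by simpa [Metric.eball_ofReal] using hyb)
  rw [zero_add, ← heq hyb] at this
  exact this

theorem analyticAt_tsum {E : Type*} [NormedAddCommGroup E] [NormedSpace ℂ E]
    {d : ℕ → E → ℂ} {a : ℕ → ℝ} {c : E} {R : ℝ} (hR : 0 < R)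
    (hd : ∀ k, AnalyticOnNhd ℂ (d k) (ball c R)) (hM : ∀ k, ∀ y ∈ ball c R, ‖d k y‖ ≤ a k)
    (ha : Summable a) : AnalyticAt ℂ (fun y => ∑' k, d k y) c := by
  choose q hq hs using fun k => fps_of_bound hR (hd k) (hM k)
  have ha0 : ∀ k, 0 ≤ a k := fun k => (norm_nonneg _).trans (hM k c (mem_ball_self hR))
  have hqs : ∀ n, Summable fun k => ‖q k n‖ := by
    intro n
    refine Summable.of_nonneg_of_le (fun _ => norm_nonneg _) (fun k => ?_)
      (ha.mul_left (3 * (1/2)^n / (R/12)^n))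
    have : 0 < (R/12)^n := by positivity
    rw [div_mul_eq_mul_div, le_div_iff₀ this]
    linarith [hq k n]
  let P : FormalMultilinearSeries ℂ E ℂ := fun n => ∑' k, q k n
  have hP : ∀ n y, HasSum (fun k => q k n (fun _ : Fin n => y)) (P n (fun _ => y)) := by
    intro n y
    exact ContinuousMultilinearMap.hasSum_eval ((hqs n).of_norm.hasSum) _
  refine ⟨P, ENNReal.ofReal (R/12), ?_, by simp; positivity, ?_⟩
  · refine P.le_radius_of_bound (r := Real.toNNReal (R/12)) (3 * ∑' k, a k) (fun n => ?_)
    rw [Real.coe_toNNReal _ (by positivity)]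
    have : ‖P n‖ ≤ ∑' k, ‖q k n‖ := norm_tsum_le_tsum_norm (hqs n)
    calc _ ≤ (∑' k, ‖q k n‖) * (R/12)^n := by gcongr
      _ = ∑' k, ‖q k n‖ * (R/12)^n := by rw [tsum_mul_right]
      _ ≤ ∑' k, 3 * a k := by
        refine Summable.tsum_le_tsum (fun k => ?_) ((hqs n).mul_right _) (ha.mul_left _)
        refine (hq k n).trans ?_
        have : (1/2 : ℝ) ^ n ≤ 1 := pow_le_one₀ (by norm_num) (by norm_num)
        nlinarith [ha0 k]
      _ = _ := tsum_mul_left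
  · intro y hy
    have hy' : ‖y‖ < R/12 := by simpa [Metric.eball_ofReal] using hy
    have hsum : Summable fun z : ℕ × ℕ => q z.1 z.2 (fun _ => y) := by
      refine Summable.of_norm_bounded (g := fun z : ℕ × ℕ => (3 * a z.1) * (1/2)^z.2) ?_ ?_
      · exact (ha.mul_left 3).mul_of_nonneg (summable_geometric_of_lt_one (by norm_num) (by norm_num))
          (fun k => by have := ha0 k; positivity) (fun k => by positivity)
      · rintro ⟨k, n⟩
        refine ((q k n).le_opNorm _).trans (le_trans ?_ (hq k n))
        simp only [Finset.prod_const, Finset.card_univ, Fintype.card_fin]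
        gcongr
    have h1 := hsum.hasSum.prod_fiberwise (fun k => hs k y hy')
    have h2 := ((Equiv.prodComm ℕ ℕ).hasSum_iff.2 hsum.hasSum).prod_fiberwise (fun n => hP n y)
    change HasSum _ (∑' k, d k (c + y))
    rw [h1.tsum_eq]
    exact h2

theorem analyticAt_lim {E : Type*} [NormedAddCommGroup E] [NormedSpace ℂ E]
    {g : ℕ → E → ℂ} {a : ℕ → ℝ} {c : E} {R : ℝ} (hR : 0 < R) (n₀ : ℕ)
    (hd : ∀ k, n₀ ≤ k → AnalyticOnNhd ℂ (g k) (ball c R))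
    (hM : ∀ k, n₀ ≤ k → ∀ y ∈ ball c R, ‖g (k+1) y - g k y‖ ≤ a k)
    (ha : Summable a) : AnalyticAt ℂ (fun y => limUnder Filter.atTop (fun n => g n y)) c := by
  have ha' : Summable fun k => a (k + n₀) := (summable_nat_add_iff n₀).2 ha
  have h := analyticAt_tsum (d := fun k y => g (k + n₀ + 1) y - g (k + n₀) y) hR
    (fun k => (hd _ (by omega)).sub (hd _ (by omega))) (fun k => hM _ (by omega)) ha'
  have h2 := (hd n₀ le_rfl c (mem_ball_self hR)).add h
  refine h2.congr ?_
  filter_upwards [ball_mem_nhds c hR] with y hy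
  symm
  refine Filter.Tendsto.limUnder_eq (f := Filter.atTop) (g := fun n => g n y) ?_
  rw [← Filter.tendsto_add_atTop_iff_nat n₀]
  have hsum : Summable fun k => g (k + n₀ + 1) y - g (k + n₀) y :=
    Summable.of_norm_bounded ha' (fun k => hM _ (by omega) y hy)
  have := (hsum.hasSum.tendsto_sum_nat).const_add (g n₀ y)
  refine this.congr (fun n => ?_)
  have := Finset.sum_range_sub (fun k => g (k + n₀) y) n
  simp only [zero_add] at this
  have e : ∀ k, k + 1 + n₀ = k + n₀ + 1 := fun k => by omega
  simp only [e] at this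
  rw [this]; ring
end partC


section partR
open Real Finset

/-- truncated exponential -/
noncomputable def ER (N : ℕ) (u : ℝ) : ℝ :=
  Real.exp (-(N * u)) * ∑ k ∈ Finset.range (N + 1), ((N : ℝ) * u) ^ k / (k.factorial : ℝ)

noncomputable def EC (N : ℕ) (w : ℂ) : ℂ :=
  Complex.exp (-(N * w)) * ∑ k ∈ Finset.range (N + 1), ((N : ℂ) * w) ^ k / (k.factorial : ℂ)

theorem EC_ofReal (N : ℕ) (u : ℝ) : EC N (u : ℂ) = (ER N u : ℝ) := by
  simp only [EC, ER]; push_cast; rfl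

theorem one_le_esum (N : ℕ) {y : ℝ} (hy : 0 ≤ y) :
    1 ≤ ∑ k ∈ Finset.range (N + 1), y ^ k / (k.factorial : ℝ) := by
  have := Finset.single_le_sum (f := fun k => y ^ k / (k.factorial : ℝ)) (s := Finset.range (N+1))
    (fun i _ => by positivity) (Finset.mem_range.2 (Nat.succ_pos N))
  simpa using this

theorem ER_pos (N : ℕ) {u : ℝ} (hu : 0 ≤ u) : 0 < ER N u :=
  mul_pos (Real.exp_pos _) (by linarith [one_le_esum N (y := N * u) (by positivity)])

theorem esum_half (N : ℕ) {y : ℝ} (hy : 0 ≤ y) :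
    ∑ k ∈ Finset.range (N + 1), y ^ k / (k.factorial : ℝ) ≤ Real.exp (N + y / 2) := by
  have h1 : ∑ k ∈ Finset.range (N + 1), y ^ k / (k.factorial : ℝ)
      ≤ 2 ^ N * ∑ k ∈ Finset.range (N + 1), (y / 2) ^ k / (k.factorial : ℝ) := by
    rw [Finset.mul_sum]
    apply Finset.sum_le_sum
    intro k hk
    have hk' : k ≤ N := Nat.lt_succ_iff.1 (Finset.mem_range.1 hk)
    rw [← mul_div_assoc]
    gcongr
    rw [div_pow, ← mul_div_assoc, le_div_iff₀ (by positivity), mul_comm]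
    gcongr
    norm_num
  have h2 := Real.sum_le_exp_of_nonneg (x := y / 2) (by positivity) (N + 1)
  have h3 : (2:ℝ) ^ N ≤ Real.exp N := by
    have : Real.exp N = Real.exp 1 ^ N := by rw [← Real.exp_nat_mul]; simp
    rw [this]
    exact pow_le_pow_left₀ (by norm_num) (by linarith [Real.exp_one_gt_d9]) _
  rw [Real.exp_add]
  refine h1.trans ?_
  gcongr

theorem norm_EC_le (N : ℕ) (w : ℂ) : ‖EC N w‖ ≤ Real.exp (-(N * (w.re - ‖w‖))) := by
  have h1 : ‖∑ k ∈ Finset.range (N + 1), ((N : ℂ) * w) ^ k / (k.factorial : ℂ)‖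
      ≤ ∑ k ∈ Finset.range (N + 1), ((N : ℝ) * ‖w‖) ^ k / (k.factorial : ℝ) := by
    refine (norm_sum_le _ _).trans (le_of_eq ?_)
    simp
  have h2 := Real.sum_le_exp_of_nonneg (x := N * ‖w‖) (by positivity) (N + 1)
  rw [EC, norm_mul, Complex.norm_exp]
  calc _ ≤ Real.exp (-((N:ℂ) * w)).re * Real.exp (N * ‖w‖) := by gcongr; exact h1.trans h2
    _ = _ := by rw [← Real.exp_add]; congr 1; simp; ring

theorem norm_EC_le' (N : ℕ) (w : ℂ) : ‖EC N w‖ ≤ Real.exp (-(N * (w.re - ‖w‖ / 2 - 1))) := by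
  have h1 : ‖∑ k ∈ Finset.range (N + 1), ((N : ℂ) * w) ^ k / (k.factorial : ℂ)‖
      ≤ ∑ k ∈ Finset.range (N + 1), ((N : ℝ) * ‖w‖) ^ k / (k.factorial : ℝ) := by
    refine (norm_sum_le _ _).trans (le_of_eq ?_)
    simp
  have h2 := esum_half N (y := N * ‖w‖) (by positivity)
  rw [EC, norm_mul, Complex.norm_exp]
  calc _ ≤ Real.exp (-((N:ℂ) * w)).re * Real.exp (N + N * ‖w‖ / 2) := by
        gcongr; exact h1.trans h2
    _ = _ := by rw [← Real.exp_add]; congr 1; simp; ring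

theorem ER_le_one (N : ℕ) {u : ℝ} (hu : 0 ≤ u) : ER N u ≤ 1 := by
  have := norm_EC_le N (u : ℂ)
  rw [EC_ofReal, Complex.norm_real, Complex.norm_real, Real.norm_of_nonneg hu,
    Real.norm_of_nonneg (ER_pos N hu).le] at this
  simpa using this

theorem ER_le_exp (N : ℕ) {u : ℝ} (hu : 0 ≤ u) : ER N u ≤ Real.exp (-(N * (u / 2 - 1))) := by
  have := norm_EC_le' N (u : ℂ)
  rw [EC_ofReal, Complex.norm_real, Complex.norm_real, Real.norm_of_nonneg hu,
    Real.norm_of_nonneg (ER_pos N hu).le] at this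
  refine this.trans (le_of_eq ?_)
  rw [Complex.ofReal_re]; congr 1; ring

theorem ER_ge (N : ℕ) {u : ℝ} (hu : 0 ≤ u) (hu2 : u ≤ 1/2) : Real.exp (-1) ≤ ER N u := by
  have hy : 0 ≤ N * u := by positivity
  have hy2 : N * u ≤ N * (1/2) := by gcongr
  have h := Complex.exp_bound' (x := ((N * u : ℝ) : ℂ)) (n := N) (by
    rw [Complex.norm_real, Real.norm_of_nonneg hy, div_le_iff₀ (by positivity)]
    push_cast; linarith)
  have h' : |Real.exp (N * u) - ∑ m ∈ Finset.range N, (N * u) ^ m / (m.factorial : ℝ)|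
      ≤ (N * u) ^ N / (N.factorial : ℝ) * 2 := by
    rw [Complex.norm_real, Real.norm_of_nonneg hy] at h
    rw [← Real.norm_eq_abs, ← Complex.norm_real]
    convert h using 2
    push_cast; rfl
  have h2 : Real.exp (N * u) ≤ 2 * ∑ k ∈ Finset.range (N + 1), ((N : ℝ) * u) ^ k / (k.factorial : ℝ) := by
    rw [Finset.sum_range_succ]
    have := (abs_le.1 h').2
    have : 0 ≤ ∑ m ∈ Finset.range N, (N * u) ^ m / (m.factorial : ℝ) :=
      Finset.sum_nonneg fun i _ => by positivity
    linarith
  have h3 : 1 ≤ 2 * ER N u := by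
    have : Real.exp (-(N * u)) * Real.exp (N * u) = 1 := by rw [← Real.exp_add]; simp
    rw [ER, ← this]
    nlinarith [Real.exp_pos (-(N * u))]
  have h4 : Real.exp (-1) ≤ 1/2 := by
    rw [Real.exp_neg, one_div]
    exact inv_anti₀ (by norm_num) (by linarith [Real.exp_one_gt_d9])
  linarith

theorem esum_hasDeriv (n : ℕ) (y : ℝ) :
    HasDerivAt (fun y : ℝ => ∑ k ∈ Finset.range (n + 1), y ^ k / (k.factorial : ℝ))
      (∑ k ∈ Finset.range n, y ^ k / (k.factorial : ℝ)) y := by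
  induction n with
  | zero => simpa using hasDerivAt_const y (1:ℝ)
  | succ n ih =>
    simp_rw [Finset.sum_range_succ _ (n + 1)]
    rw [Finset.sum_range_succ _ n]
    refine ih.add ?_
    have := (hasDerivAt_pow (n + 1) y).div_const ((n + 1).factorial : ℝ)
    refine this.congr_deriv ?_
    rw [Nat.factorial_succ]; rw [Nat.add_sub_cancel]; push_cast; field_simp

theorem esum_anti (n : ℕ) : AntitoneOn
    (fun y : ℝ => Real.exp (-y) * ∑ k ∈ Finset.range (n + 1), y ^ k / (k.factorial : ℝ)) (Set.Ici 0) := by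
  have hd : ∀ y : ℝ, HasDerivAt (fun y : ℝ => Real.exp (-y) * ∑ k ∈ Finset.range (n + 1), y ^ k / (k.factorial : ℝ))
     (-(Real.exp (-y) * (y ^ n / (n.factorial : ℝ)))) y := by
    intro y
    have := ((hasDerivAt_neg y).exp).fun_mul (esum_hasDeriv n y)
    refine this.congr_deriv ?_
    rw [Finset.sum_range_succ]; ring
  apply antitoneOn_of_deriv_nonpos (convex_Ici 0)
  · exact fun y _ => (hd y).continuousAt.continuousWithinAt
  · exact fun y _ => (hd y).differentiableAt.differentiableWithinAt
  · intro y hy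
    rw [interior_Ici] at hy
    have hy' : 0 < y := hy
    rw [(hd y).deriv]
    have : 0 ≤ Real.exp (-y) * (y ^ n / (n.factorial : ℝ)) := by positivity
    linarith

theorem ER_lip (N : ℕ) {u v D : ℝ} (hu : 0 ≤ u) (hv : 0 ≤ v) (h : |u - v| ≤ D) :
    ER N u ≤ Real.exp (N * D) * ER N v := by
  have hD : 0 ≤ D := (abs_nonneg _).trans h
  rcases le_total v u with huv | huv
  · have := esum_anti N (a := N * v) (b := N * u) (Set.mem_Ici.2 (by positivity))
      (Set.mem_Ici.2 (by positivity)) (by gcongr)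
    have h1 : ER N u ≤ ER N v := this
    have h2 : 1 ≤ Real.exp (N * D) := Real.one_le_exp (by positivity)
    nlinarith [ER_pos N hv]
  · rw [ER, ER, ← mul_assoc, ← Real.exp_add]
    have : |u - v| = v - u := by rw [abs_of_nonpos] <;> linarith
    gcongr
    have : N * (v - u) ≤ N * D := by gcongr; linarith
    linarith

/-- soft-min step -/
noncomputable def stR (l t W : ℝ) : ℝ := t - l⁻¹ * Real.log (1 + Real.exp (l * t) * W)
noncomputable def stC (l t W : ℂ) : ℂ := t - l⁻¹ * Complex.log (1 + Complex.exp (l * t) * W)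

theorem stC_ofReal (l t W : ℝ) (hW : 0 ≤ W) : stC l t W = (stR l t W : ℝ) := by
  simp only [stC, stR]
  push_cast
  rw [Complex.ofReal_log (by positivity)]
  push_cast; rfl

theorem exp_stR {l : ℝ} (hl : 0 < l) (t : ℝ) {W : ℝ} (hW : 0 ≤ W) :
    Real.exp (-(l * stR l t W)) = Real.exp (-(l * t)) + W := by
  have : -(l * stR l t W) = -(l * t) + Real.log (1 + Real.exp (l * t) * W) := by
    rw [stR]; field_simp; ring
  rw [this, Real.exp_add, Real.exp_log (by positivity), mul_add, ← mul_assoc, ← Real.exp_add]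
  simp

theorem stR_le {l : ℝ} (hl : 0 < l) {t W b : ℝ} (hW : Real.exp (-(l * b)) ≤ W) :
    stR l t W ≤ b := by
  have h := exp_stR hl t ((Real.exp_pos _).le.trans hW)
  have : Real.exp (-(l * b)) ≤ Real.exp (-(l * stR l t W)) := by
    rw [h]; linarith [Real.exp_pos (-(l * t))]
  rw [Real.exp_le_exp] at this
  nlinarith

theorem stR_le_self {l : ℝ} (hl : 0 < l) {t W : ℝ} (hW : 0 ≤ W) : stR l t W ≤ t := by
  have h := exp_stR hl t hW
  have : Real.exp (-(l * t)) ≤ Real.exp (-(l * stR l t W)) := by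
    rw [h]; linarith
  rw [Real.exp_le_exp] at this
  nlinarith

theorem le_stR {l : ℝ} (hl : 0 < l) {t W m : ℝ} (hW0 : 0 ≤ W) (hW : W ≤ Real.exp (-(l * m))) {m' : ℝ}
    (hm' : m' ≤ m) (hm : m' ≤ t) : m' - 1 / l ≤ stR l t W := by
  have h := exp_stR hl t hW0
  have h1 : Real.exp (-(l * t)) ≤ Real.exp (-(l * m')) := by
    rw [Real.exp_le_exp]; nlinarith
  have h1' : Real.exp (-(l * m)) ≤ Real.exp (-(l * m')) := by
    rw [Real.exp_le_exp]; nlinarith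
  have h2 : Real.exp (-(l * stR l t W)) ≤ Real.exp (-(l * (m' - 1 / l))) := by
    have e : -(l * (m' - 1 / l)) = 1 + -(l * m') := by field_simp; ring
    rw [h, e, Real.exp_add]
    nlinarith [Real.exp_pos (-(l * m')), Real.exp_one_gt_d9]
  rw [Real.exp_le_exp] at h2
  nlinarith

theorem stR_lip {l : ℝ} (hl : 0 < l) {t W t' W' D : ℝ} (hW : 0 ≤ W) (hW' : 0 ≤ W')
    (ht : t - D ≤ t') (hWW : W' ≤ Real.exp (l * D) * W) : stR l t W - D ≤ stR l t' W' := by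
  have h := exp_stR hl t hW
  have h' := exp_stR hl t' hW'
  have h2 : Real.exp (-(l * stR l t' W')) ≤ Real.exp (-(l * (stR l t W - D))) := by
    have e : -(l * (stR l t W - D)) = l * D + -(l * stR l t W) := by ring
    rw [e, Real.exp_add, h, h', mul_add, ← Real.exp_add]
    have : Real.exp (-(l * t')) ≤ Real.exp (l * D + -(l * t)) := by
      rw [Real.exp_le_exp]; nlinarith
    linarith
  rw [Real.exp_le_exp] at h2
  nlinarith

theorem norm_stC_sub {l : ℝ} (hl : 0 < l) {t W : ℂ} (h : ‖Complex.exp (l * t) * W‖ ≤ 1/2) :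
    ‖stC l t W - t‖ ≤ 1 / l := by
  have h1 := Complex.norm_log_one_add_half_le_self h
  have : stC l t W - t = - ((l:ℂ)⁻¹ * Complex.log (1 + Complex.exp (l * t) * W)) := by
    rw [stC]; ring
  rw [this, norm_neg, norm_mul, norm_inv, Complex.norm_real, Real.norm_of_nonneg hl.le, one_div]
  have : ‖Complex.log (1 + Complex.exp (l * t) * W)‖ ≤ 1 := by linarith
  have : 0 < l⁻¹ := by positivity
  nlinarith
end partR


section partS
open Finset

noncomputable def itR (l : ℕ → ℝ) (t0 : ℝ) (W : ℕ → ℝ) : ℕ → ℝ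
  | 0 => t0
  | n + 1 => stR (l n) (itR l t0 W n) (W n)

noncomputable def itC (l : ℕ → ℝ) (t0 : ℝ) (W : ℕ → ℂ) : ℕ → ℂ
  | 0 => t0
  | n + 1 => stC (l n) (itC l t0 W n) (W n)

theorem itC_ofReal (l : ℕ → ℝ) (t0 : ℝ) {W : ℕ → ℝ} {Wc : ℕ → ℂ} (n : ℕ) (hW : ∀ j < n, 0 ≤ W j)
    (hc : ∀ j < n, Wc j = W j) : itC l t0 Wc n = (itR l t0 W n : ℝ) := by
  induction n with
  | zero => rfl
  | succ n ih =>
    rw [itC, itR, ih (fun j hj => hW j (hj.trans n.lt_succ_self))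
      (fun j hj => hc j (hj.trans n.lt_succ_self)), hc n n.lt_succ_self,
      stC_ofReal _ _ _ (hW n n.lt_succ_self)]

theorem itR_anti {l : ℕ → ℝ} (hl : ∀ j, 0 < l j) (t0 : ℝ) {W : ℕ → ℝ} (hW : ∀ j, 0 ≤ W j) :
    Antitone (itR l t0 W) :=
  antitone_nat_of_succ_le fun n => stR_le_self (hl n) (hW n)

theorem le_itR {l : ℕ → ℝ} (hl : ∀ j, 0 < l j) {t0 m : ℝ} {W : ℕ → ℝ} (hW : ∀ j, 0 ≤ W j)
    (hm : m ≤ t0) (n : ℕ) (h : ∀ j < n, W j ≤ Real.exp (-(l j * m))) :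
    m - ∑ j ∈ range n, 1 / l j ≤ itR l t0 W n := by
  induction n with
  | zero => simpa [itR] using hm
  | succ n ih =>
    have ih' := ih fun j hj => h j (hj.trans n.lt_succ_self)
    rw [sum_range_succ, itR, ← sub_sub]
    refine le_stR (hl n) (hW n) (h n n.lt_succ_self) ?_ ih'
    have : 0 ≤ ∑ j ∈ range n, 1 / l j := sum_nonneg fun j _ => (one_div_pos.2 (hl j)).le
    linarith

theorem itR_lip {l : ℕ → ℝ} (hl : ∀ j, 0 < l j) {t0 D : ℝ} (hD : 0 ≤ D) {W W' : ℕ → ℝ}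
    (hW : ∀ j, 0 ≤ W j) (hW' : ∀ j, 0 ≤ W' j) (n : ℕ)
    (h : ∀ j < n, W' j ≤ Real.exp (l j * D) * W j) :
    itR l t0 W n - D ≤ itR l t0 W' n := by
  induction n with
  | zero => simpa [itR] using hD
  | succ n ih =>
    exact stR_lip (hl n) (hW n) (hW' n) (ih fun j hj => h j (hj.trans n.lt_succ_self))
      (h n n.lt_succ_self)

theorem stC_analyticAt {E : Type*} [NormedAddCommGroup E] [NormedSpace ℂ E] {l : ℝ} {t W : E → ℂ}
    {c : E} (ht : AnalyticAt ℂ t c) (hW : AnalyticAt ℂ W c)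
    (h : 1 + Complex.exp (l * t c) * W c ∈ Complex.slitPlane) :
    AnalyticAt ℂ (fun y => stC l (t y) (W y)) c := by
  unfold stC
  have h1 : AnalyticAt ℂ (fun y => 1 + Complex.exp (l * t y) * W y) c :=
    analyticAt_const.add (((analyticAt_const.mul ht).cexp).mul hW)
  exact ht.sub (analyticAt_const.mul (h1.clog h))

theorem itC_analyticAt {E : Type*} [NormedAddCommGroup E] [NormedSpace ℂ E] (l : ℕ → ℝ) (t0 : ℝ)
    {W : E → ℕ → ℂ} {c : E} {w : ℕ → ℝ} (hw : ∀ j, 0 ≤ w j) (n : ℕ) 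
    (hc : ∀ j < n, W c j = w j)
    (hW : ∀ j < n, AnalyticAt ℂ (fun y => W y j) c) :
    AnalyticAt ℂ (fun y => itC l t0 (W y) n) c := by
  induction n with
  | zero => exact analyticAt_const
  | succ n ih =>
    refine stC_analyticAt (ih (fun j hj => hc j (hj.trans n.lt_succ_self))
      (fun j hj => hW j (hj.trans n.lt_succ_self))) (hW n n.lt_succ_self) ?_
    rw [itC_ofReal l t0 n (fun j _ => hw j) (fun j hj => hc j (hj.trans n.lt_succ_self)),
      hc n n.lt_succ_self]
    left
    rw [← Complex.ofReal_mul, ← Complex.ofReal_exp, ← Complex.ofReal_mul, ← Complex.ofReal_one,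
      ← Complex.ofReal_add, Complex.ofReal_re]
    have := hw n
    positivity

theorem itC_tail {E : Type*} [NormedAddCommGroup E] [NormedSpace ℂ E] {l : ℕ → ℝ}
    (hl : ∀ j, 0 < l j) (b : ℝ) {W : E → ℕ → ℂ} {s : Set E} {n0 : ℕ} {t0 γ : ℝ}
    (h0 : AnalyticOnNhd ℂ (fun y => itC l b (W y) n0) s)
    (h0' : ∀ y ∈ s, (itC l b (W y) n0).re ≤ t0 + γ)
    (hlγ : ∀ n, n0 ≤ n → Real.exp (-(l n * γ)) ≤ 1/2)
    (hsum : ∀ n, ∑ j ∈ Ico n0 n, 1 / l j ≤ γ) (n : ℕ) (hn : n0 ≤ n)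
    (hW : ∀ k, n0 ≤ k → k < n → AnalyticOnNhd ℂ (fun y => W y k) s)
    (hWb : ∀ k, n0 ≤ k → k < n → ∀ y ∈ s, ‖W y k‖ ≤ Real.exp (-(l k * (t0 + 3 * γ)))) :
    AnalyticOnNhd ℂ (fun y => itC l b (W y) n) s ∧
    (∀ y ∈ s, (itC l b (W y) n).re ≤ t0 + γ + ∑ j ∈ Ico n0 n, 1 / l j) ∧
    (∀ k, n0 ≤ k → k < n → ∀ y ∈ s, ‖itC l b (W y) (k+1) - itC l b (W y) k‖ ≤ 1 / l k) := by
  induction n, hn using Nat.le_induction with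
  | base =>
    refine ⟨h0, by simpa using h0', fun k hk hk' => by omega⟩
  | succ n hn ih =>
    obtain ⟨i1, i2, i3⟩ := ih (fun k hk hk' => hW k hk (hk'.trans n.lt_succ_self))
      (fun k hk hk' => hWb k hk (hk'.trans n.lt_succ_self))
    have key : ∀ y ∈ s, ‖Complex.exp (l n * itC l b (W y) n) * W y n‖ ≤ 1/2 := by
      intro y hy
      rw [norm_mul, Complex.norm_exp]
      have h1 := i2 y hy
      have h2 := hsum n
      have h3 := hWb n hn n.lt_succ_self y hy
      have h4 : ((l n : ℂ) * itC l b (W y) n).re ≤ l n * (t0 + 2 * γ) := by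
        rw [Complex.re_ofReal_mul]
        have := hl n
        gcongr; linarith
      calc _ ≤ Real.exp (l n * (t0 + 2 * γ)) * Real.exp (-(l n * (t0 + 3 * γ))) := by
            gcongr
        _ = Real.exp (-(l n * γ)) := by rw [← Real.exp_add]; congr 1; ring
        _ ≤ _ := hlγ n hn
    have key2 : ∀ y ∈ s, ‖itC l b (W y) (n+1) - itC l b (W y) n‖ ≤ 1 / l n :=
      fun y hy => norm_stC_sub (hl n) (key y hy)
    refine ⟨fun y hy => ?_, fun y hy => ?_, fun k hk hk' y hy => ?_⟩
    · refine stC_analyticAt (i1 y hy) (hW n hn n.lt_succ_self y hy) ?_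
      left
      have h5 := Complex.abs_re_le_norm (Complex.exp (l n * itC l b (W y) n) * W y n)
      have h6 := key y hy
      rw [Complex.add_re, Complex.one_re]
      have := (abs_le.1 (h5.trans h6)).1
      linarith
    · rw [Finset.sum_Ico_succ_top hn]
      have h5 := Complex.re_le_norm (itC l b (W y) (n+1) - itC l b (W y) n)
      have h6 := key2 y hy
      have h7 := i2 y hy
      rw [Complex.sub_re] at h5
      linarith
    · rcases Nat.lt_succ_iff_lt_or_eq.1 hk' with h | rfl
      · exact i3 k hk h y hy
      · exact key2 y hy

end partS


section partT
open Finset Filter Topology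

/-- thresholds -/
noncomputable def cth (j : ℕ) : ℝ := (1 - (1/2)^j) / 4

theorem cth_nonneg (j : ℕ) : 0 ≤ cth j := by
  have : ((1:ℝ)/2)^j ≤ 1 := pow_le_one₀ (by norm_num) (by norm_num)
  unfold cth; linarith
theorem cth_le (j : ℕ) : cth j ≤ 1/4 := by
  have : 0 < ((1:ℝ)/2)^j := by positivity
  unfold cth; linarith
theorem cth_mono : Monotone cth := by
  refine monotone_nat_of_le_succ fun n => ?_
  have : 0 < ((1:ℝ)/2)^n := by positivity
  unfold cth; rw [pow_succ]; linarith

/-- scale parameters -/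
def Nsc (N0 : ℕ) (j : ℕ) : ℕ := N0 * 4 ^ j
noncomputable def lsc (N0 : ℕ) (j : ℕ) : ℝ := (Nsc N0 j : ℝ)

theorem lsc_pos {N0 : ℕ} (h : 0 < N0) (j : ℕ) : 0 < lsc N0 j := by
  unfold lsc Nsc; positivity
theorem lsc_succ (N0 j : ℕ) : lsc N0 (j+1) = 4 * lsc N0 j := by
  unfold lsc Nsc; push_cast; ring
theorem lsc_zero (N0 : ℕ) : lsc N0 0 = N0 := by
  unfold lsc Nsc; push_cast; ring
theorem lsc_mono {N0 : ℕ} (h : 0 < N0) : Monotone (lsc N0) :=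
  monotone_nat_of_le_succ fun n => by rw [lsc_succ]; linarith [lsc_pos h n]
theorem lsc_tendsto {N0 : ℕ} (h : 0 < N0) : Tendsto (lsc N0) atTop atTop := by
  have : lsc N0 = fun j => (N0:ℝ) * 4 ^ j := by
    ext j; unfold lsc Nsc; push_cast; ring
  rw [this]
  exact (tendsto_pow_atTop_atTop_of_one_lt (by norm_num)).const_mul_atTop (by positivity)

theorem lsc_sum {N0 : ℕ} (h : 0 < N0) (a n : ℕ) : ∑ j ∈ Ico a n, 1 / lsc N0 j ≤ 2 / lsc N0 a := by
  rcases le_total n a with hn | hn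
  · rw [Ico_eq_empty_of_le hn, sum_empty]
    have := lsc_pos h a; positivity
  suffices ∑ j ∈ Ico a n, 1 / lsc N0 j ≤ 2 / lsc N0 a - 2 / lsc N0 n by
    have h1 := lsc_pos h n
    have : 0 < 2 / lsc N0 n := by positivity
    linarith
  induction n, hn using Nat.le_induction with
  | base => simp
  | succ n hn ih =>
    rw [Finset.sum_Ico_succ_top hn, lsc_succ]
    have h1 := lsc_pos h n
    have e1 : 2 / (4 * lsc N0 n) = (1/2) * (1 / lsc N0 n) := by field_simp; norm_num
    have e2 : 2 / lsc N0 n = 2 * (1 / lsc N0 n) := by field_simp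
    have : 0 < 1 / lsc N0 n := by positivity
    rw [e1]; rw [e2] at ih
    linarith

theorem lsc_sum' {N0 : ℕ} (h : 0 < N0) (n : ℕ) : ∑ j ∈ range n, 1 / lsc N0 j ≤ 2 / N0 := by
  rw [range_eq_Ico]; have := lsc_sum h 0 n; rwa [lsc_zero] at this

noncomputable def WSR (N0 : ℕ) (u : ℕ → ℝ) (j : ℕ) : ℝ :=
  Real.exp (-(lsc N0 j * cth j)) * ER (Nsc N0 j) (u j)
noncomputable def SR (N0 : ℕ) (u : ℕ → ℝ) : ℕ → ℝ := itR (lsc N0) 1 (WSR N0 u)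
noncomputable def WTR (N0 : ℕ) (f : ℕ → ℝ) (η : ℝ) (u : ℕ → ℝ) (j : ℕ) : ℝ :=
  Real.exp (-(lsc N0 j * (f j + η * (1 - SR N0 u j)))) * ER (Nsc N0 j) (u j / 8)
noncomputable def TR (N0 : ℕ) (f : ℕ → ℝ) (η M : ℝ) (u : ℕ → ℝ) : ℕ → ℝ :=
  itR (lsc N0) (M + 1) (WTR N0 f η u)

noncomputable def WSC (N0 : ℕ) (u : ℕ → ℂ) (j : ℕ) : ℂ :=
  Complex.exp (-(lsc N0 j * cth j)) * EC (Nsc N0 j) (u j)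
noncomputable def SC (N0 : ℕ) (u : ℕ → ℂ) : ℕ → ℂ := itC (lsc N0) 1 (WSC N0 u)
noncomputable def WTC (N0 : ℕ) (f : ℕ → ℝ) (η : ℝ) (u : ℕ → ℂ) (j : ℕ) : ℂ :=
  Complex.exp (-(lsc N0 j * (f j + η * (1 - SC N0 u j)))) * EC (Nsc N0 j) (u j / 8)
noncomputable def TC (N0 : ℕ) (f : ℕ → ℝ) (η M : ℝ) (u : ℕ → ℂ) : ℕ → ℂ :=
  itC (lsc N0) (M + 1) (WTC N0 f η u)

theorem WSR_nonneg (N0 : ℕ) {u : ℕ → ℝ} (hu : ∀ j, 0 ≤ u j) (j : ℕ) : 0 ≤ WSR N0 u j :=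
  mul_nonneg (Real.exp_pos _).le (ER_pos _ (hu j)).le
theorem WTR_nonneg (N0 : ℕ) (f : ℕ → ℝ) (η : ℝ) {u : ℕ → ℝ} (hu : ∀ j, 0 ≤ u j) (j : ℕ) :
    0 ≤ WTR N0 f η u j :=
  mul_nonneg (Real.exp_pos _).le (ER_pos _ (by have := hu j; positivity)).le

theorem WSC_ofReal (N0 : ℕ) {u : ℕ → ℝ} {uc : ℕ → ℂ} (h : ∀ j, uc j = u j) (j : ℕ) :
    WSC N0 uc j = WSR N0 u j := by
  unfold WSC WSR; rw [h, EC_ofReal]; push_cast; rfl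
theorem SC_ofReal (N0 : ℕ) {u : ℕ → ℝ} (hu : ∀ j, 0 ≤ u j) {uc : ℕ → ℂ} (h : ∀ j, uc j = u j) (n : ℕ) :
    SC N0 uc n = SR N0 u n := 
  itC_ofReal _ _ n (fun j _ => WSR_nonneg N0 hu j) (fun j _ => WSC_ofReal N0 h j)
theorem WTC_ofReal (N0 : ℕ) (f : ℕ → ℝ) (η : ℝ) {u : ℕ → ℝ} (hu : ∀ j, 0 ≤ u j) {uc : ℕ → ℂ}
    (h : ∀ j, uc j = u j) (j : ℕ) : WTC N0 f η uc j = WTR N0 f η u j := by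
  have : ((u j : ℂ) / 8) = ((u j / 8 : ℝ) : ℂ) := by push_cast; rfl
  unfold WTC WTR; rw [h, this, EC_ofReal, SC_ofReal N0 hu h]; push_cast; rfl
theorem TC_ofReal (N0 : ℕ) (f : ℕ → ℝ) (η M : ℝ) {u : ℕ → ℝ} (hu : ∀ j, 0 ≤ u j) {uc : ℕ → ℂ}
    (h : ∀ j, uc j = u j) (n : ℕ) : TC N0 f η M uc n = TR N0 f η M u n := 
  itC_ofReal _ _ n (fun j _ => WTR_nonneg N0 f η hu j) (fun j _ => WTC_ofReal N0 f η hu h j)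

theorem SR_anti {N0 : ℕ} (h : 0 < N0) {u : ℕ → ℝ} (hu : ∀ j, 0 ≤ u j) : Antitone (SR N0 u) :=
  itR_anti (lsc_pos h) _ (WSR_nonneg N0 hu)
theorem TR_anti {N0 : ℕ} (h : 0 < N0) (f : ℕ → ℝ) (η M : ℝ) {u : ℕ → ℝ} (hu : ∀ j, 0 ≤ u j) :
    Antitone (TR N0 f η M u) :=
  itR_anti (lsc_pos h) _ (WTR_nonneg N0 f η hu)

theorem SR_le_one {N0 : ℕ} (h : 0 < N0) {u : ℕ → ℝ} (hu : ∀ j, 0 ≤ u j) (n : ℕ) : SR N0 u n ≤ 1 :=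
  SR_anti h hu (Nat.zero_le n)

theorem SR_ge {N0 : ℕ} (h : 0 < N0) {u : ℕ → ℝ} (hu : ∀ j, 0 ≤ u j) (n : ℕ) (h4 : ∀ j < n, 4 ≤ u j) :
    1 - 2 / N0 ≤ SR N0 u n := by
  have := le_itR (lsc_pos h) (W := WSR N0 u) (t0 := 1) (m := 1) (WSR_nonneg N0 hu) le_rfl n ?_
  · exact le_trans (by linarith [lsc_sum' h n]) this
  · intro j hj
    have h1 : Real.exp (-(lsc N0 j * cth j)) ≤ 1 := by
      rw [Real.exp_le_one_iff]
      have := mul_nonneg (lsc_pos h j).le (cth_nonneg j); linarith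
    have h2 := ER_le_exp (Nsc N0 j) (hu j)
    have h3 : Real.exp (-((Nsc N0 j : ℝ) * (u j / 2 - 1))) ≤ Real.exp (-(lsc N0 j * 1)) := by
      rw [Real.exp_le_exp]
      have h5 : (Nsc N0 j : ℝ) = lsc N0 j := rfl
      rw [h5]
      nlinarith [h4 j hj, lsc_pos h j]
    have h5 := (ER_pos (Nsc N0 j) (hu j))
    unfold WSR
    nlinarith

theorem SR_le {N0 : ℕ} (h : 16 ≤ N0) {u : ℕ → ℝ} (hu : ∀ j, 0 ≤ u j) (n : ℕ) (h4 : u n ≤ 1/2) :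
    SR N0 u (n+1) ≤ cth (n+1) - (1/2)^n/16 := by
  have hp := lsc_pos (by omega : 0 < N0) n
  have h1 : SR N0 u (n+1) ≤ cth n + 1 / lsc N0 n := by
    apply stR_le hp
    have : -(lsc N0 n * (cth n + 1 / lsc N0 n)) = -(lsc N0 n * cth n) + -1 := by field_simp; ring
    rw [this, Real.exp_add]
    unfold WSR
    gcongr
    exact ER_ge _ (hu n) h4
  have h2 : 1 / lsc N0 n ≤ (1/2)^n/16 := by
    rw [one_div_pow, div_div]
    apply one_div_le_one_div_of_le (by positivity)
    unfold lsc Nsc; push_cast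
    have : (16:ℝ) ≤ N0 := by exact_mod_cast h
    have h' : (2:ℝ)^n ≤ 4^n := by gcongr; norm_num
    nlinarith [show (0:ℝ) < 2^n by positivity]
  unfold cth at *
  rw [pow_succ]
  linarith

/-- good points -/
structure GoodPt (f : ℕ → ℝ) (η M : ℝ) (u : ℕ → ℝ) (Fx : ℝ) : Prop where
  nonneg : ∀ j, 0 ≤ u j
  near : ∀ j, u j ≤ 16 * (2 * M + 3) → |f j - Fx| ≤ η / 8
  cover : ∃ j, u j ≤ 1/2
  bd : |Fx| ≤ M

theorem TR_le {N0 : ℕ} (h : 16 ≤ N0) {f : ℕ → ℝ} {η M : ℝ} {u : ℕ → ℝ} {Fx : ℝ}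
    (hη : 0 < η) (hη1 : η ≤ 1) (hN : 2 / (N0:ℝ) ≤ η / 16) (hg : GoodPt f η M u Fx) (n : ℕ) (hn : u n ≤ 1/2)
    (m : ℕ) (hm : n < m) : TR N0 f η M u m ≤ Fx + η / 4 := by
  have hu := hg.nonneg
  have hM : 0 ≤ M := (abs_nonneg _).trans hg.bd
  have h0 : 0 < N0 := by omega
  have hex : ∃ j, u j ≤ 4 := ⟨n, by linarith⟩
  classical
  set k := Nat.find hex
  have hk : u k ≤ 4 := Nat.find_spec hex
  have hkn : k ≤ n := Nat.find_min' hex (by linarith)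
  have hlt : ∀ j < k, 4 ≤ u j := fun j hj => (not_le.1 (Nat.find_min hex hj)).le
  have hS := SR_ge h0 hu k hlt
  refine (TR_anti h0 f η M hu (by omega : k + 1 ≤ m)).trans ?_
  have hp := lsc_pos h0 k
  have h1 : TR N0 f η M u (k+1) ≤ (f k + η * (1 - SR N0 u k)) + 1 / lsc N0 k := by
    apply stR_le hp
    have : -(lsc N0 k * ((f k + η * (1 - SR N0 u k)) + 1 / lsc N0 k))
      = -(lsc N0 k * (f k + η * (1 - SR N0 u k))) + -1 := by field_simp; ring
    rw [this, Real.exp_add]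
    unfold WTR
    gcongr
    exact ER_ge _ (by have := hu k; positivity) (by linarith)
  have h2 := (abs_le.1 (hg.near k (by linarith))).2
  have h3 : 1 / lsc N0 k ≤ 2 / N0 := by
    have := lsc_sum' h0 (k+1)
    rw [sum_range_succ] at this
    have : 0 ≤ ∑ j ∈ range k, 1 / lsc N0 j := sum_nonneg fun j _ => (one_div_pos.2 (lsc_pos h0 j)).le
    linarith
  have h4 : η * (1 - SR N0 u k) ≤ η / 16 := by
    have : 1 - SR N0 u k ≤ 1/16 := by linarith
    nlinarith
  linarith

theorem TR_ge {N0 : ℕ} (h : 16 ≤ N0) {f : ℕ → ℝ} {η M : ℝ} {u : ℕ → ℝ} {Fx : ℝ}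
    (hf : ∀ j, |f j| ≤ M)
    (hη : 0 < η) (hN : 2 / (N0:ℝ) ≤ η / 16) (hg : GoodPt f η M u Fx) (n : ℕ) :
    Fx - η / 4 ≤ TR N0 f η M u n := by
  have hu := hg.nonneg
  have hM : 0 ≤ M := (abs_nonneg _).trans hg.bd
  have h0 : 0 < N0 := by omega
  have hF := abs_le.1 hg.bd
  have := le_itR (lsc_pos h0) (W := WTR N0 f η u) (t0 := M + 1) (m := Fx - η / 8)
    (WTR_nonneg N0 f η hu) (by linarith) n ?_
  · exact le_trans (by linarith [lsc_sum' h0 n]) this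
  · intro j hj
    have hp := lsc_pos h0 j
    have hS := SR_le_one h0 hu j
    have hS' : 0 ≤ η * (1 - SR N0 u j) := mul_nonneg hη.le (by linarith)
    have hu8 : 0 ≤ u j / 8 := by have := hu j; positivity
    unfold WTR
    by_cases hc : u j ≤ 16 * (2 * M + 3)
    · have h1 := (abs_le.1 (hg.near j hc)).1
      have h2 := ER_le_one (Nsc N0 j) hu8
      refine (mul_le_of_le_one_right (Real.exp_pos _).le h2).trans ?_
      rw [Real.exp_le_exp]
      nlinarith
    · have h2 := ER_le_exp (Nsc N0 j) hu8
      refine (mul_le_mul_of_nonneg_left h2 (Real.exp_pos _).le).trans ?_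
      rw [← Real.exp_add, Real.exp_le_exp]
      have h5 : (Nsc N0 j : ℝ) = lsc N0 j := rfl
      have h6 := (abs_le.1 (hf j)).1
      rw [h5]
      push Not at hc
      nlinarith

theorem SR_lip {N0 : ℕ} (h0 : 0 < N0) {u v : ℕ → ℝ} (hu : ∀ j, 0 ≤ u j) (hv : ∀ j, 0 ≤ v j) {D : ℝ}
    (hD : ∀ j, |u j - v j| ≤ D) (n : ℕ) : SR N0 u n - D ≤ SR N0 v n := by
  refine itR_lip (lsc_pos h0) ((abs_nonneg _).trans (hD 0)) (WSR_nonneg N0 hu) (WSR_nonneg N0 hv) n ?_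
  intro j _
  unfold WSR
  have := ER_lip (D := D) (Nsc N0 j) (hv j) (hu j) (by rw [abs_sub_comm]; exact hD j)
  refine (mul_le_mul_of_nonneg_left this (Real.exp_pos _).le).trans (le_of_eq ?_)
  unfold lsc; ring

theorem TR_lip {N0 : ℕ} (h0 : 0 < N0) (f : ℕ → ℝ) {η : ℝ} (hη : 0 < η) (M : ℝ) {u v : ℕ → ℝ} (hu : ∀ j, 0 ≤ u j)
    (hv : ∀ j, 0 ≤ v j) {D : ℝ}
    (hD : ∀ j, |u j - v j| ≤ D) (n : ℕ) : TR N0 f η M u n - (η + 1) * D ≤ TR N0 f η M v n := by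
  have hD0 := ((abs_nonneg _).trans (hD 0))
  refine itR_lip (lsc_pos h0) (by positivity) (WTR_nonneg N0 f η hu) (WTR_nonneg N0 f η hv) n ?_
  intro j _
  unfold WTR
  have h1 := ER_lip (Nsc N0 j) (u := v j / 8) (v := u j / 8) (by have := hv j; positivity)
    (by have := hu j; positivity) (D := D) (by
      rw [← sub_div, abs_div, abs_sub_comm, abs_of_pos (by norm_num : (0:ℝ) < 8)]
      linarith [hD j])
  have h2 := SR_lip h0 hv hu (D := D) (fun j => by rw [abs_sub_comm]; exact hD j) j
  have hp := lsc_pos h0 j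
  have h3 : Real.exp (-(lsc N0 j * (f j + η * (1 - SR N0 v j)))) ≤
      Real.exp (lsc N0 j * (η * D) + -(lsc N0 j * (f j + η * (1 - SR N0 u j)))) := by
    rw [Real.exp_le_exp]
    have : 0 < lsc N0 j * η := by positivity
    nlinarith
  have hE := ER_pos (Nsc N0 j) (u := v j / 8) (by have := hv j; positivity)
  refine (mul_le_mul h3 h1 hE.le (Real.exp_pos _).le).trans (le_of_eq ?_)
  have e : Real.exp (lsc N0 j * ((η + 1) * D)) = Real.exp (lsc N0 j * (η * D)) * Real.exp (Nsc N0 j * D) := by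
    rw [← Real.exp_add]; congr 1; unfold lsc; ring
  rw [e, Real.exp_add]; ring

end partT


section partA
open Finset Filter Topology Metric
open scoped BoundedContinuousFunction

theorem coord_an (j : ℕ) (c : ℕ →ᵇ ℂ) : AnalyticAt ℂ (fun y : ℕ →ᵇ ℂ => y j) c :=
  (BoundedContinuousFunction.evalCLM ℂ (β := ℂ) j).analyticAt c

theorem EC_an {E : Type*} [NormedAddCommGroup E] [NormedSpace ℂ E] (N : ℕ) {w : E → ℂ} {c : E}
    (hw : AnalyticAt ℂ w c) : AnalyticAt ℂ (fun y => EC N (w y)) c := by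
  unfold EC
  refine ((analyticAt_const.mul hw).neg.cexp).mul ?_
  refine Finset.analyticAt_fun_sum _ fun k _ => ?_
  exact ((analyticAt_const.mul hw).pow k).div_const

theorem WSC_an (N0 j : ℕ) (c : ℕ →ᵇ ℂ) : AnalyticAt ℂ (fun y : ℕ →ᵇ ℂ => WSC N0 y j) c :=
  analyticAt_const.mul (EC_an _ (coord_an j c))

theorem WTC_an (N0 : ℕ) (f : ℕ → ℝ) (η : ℝ) (j : ℕ) (c : ℕ →ᵇ ℂ)
    (h : AnalyticAt ℂ (fun y : ℕ →ᵇ ℂ => SC N0 y j) c) :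
    AnalyticAt ℂ (fun y : ℕ →ᵇ ℂ => WTC N0 f η y j) c := by
  unfold WTC
  refine AnalyticAt.mul ?_ (EC_an _ (coord_an j c).div_const)
  exact (analyticAt_const.mul (analyticAt_const.add
    (analyticAt_const.mul (analyticAt_const.sub h)))).neg.cexp

theorem SC_an (N0 : ℕ) {c : ℕ →ᵇ ℂ} {u : ℕ → ℝ} (hu : ∀ j, 0 ≤ u j) (hc : ∀ j, c j = u j) (n : ℕ) :
    AnalyticAt ℂ (fun y : ℕ →ᵇ ℂ => SC N0 y n) c :=
  itC_analyticAt (W := fun y : ℕ →ᵇ ℂ => WSC N0 y) _ _ (WSR_nonneg N0 hu) n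
    (fun j _ => WSC_ofReal N0 hc j) (fun j _ => WSC_an N0 j c)

theorem TC_an (N0 : ℕ) (f : ℕ → ℝ) (η M : ℝ) {c : ℕ →ᵇ ℂ} {u : ℕ → ℝ} (hu : ∀ j, 0 ≤ u j)
    (hc : ∀ j, c j = u j) (n : ℕ) :
    AnalyticAt ℂ (fun y : ℕ →ᵇ ℂ => TC N0 f η M y n) c :=
  itC_analyticAt (W := fun y : ℕ →ᵇ ℂ => WTC N0 f η y) _ _ (WTR_nonneg N0 f η hu) n
    (fun j _ => WTC_ofReal N0 f η hu hc j) (fun j _ => WTC_an N0 f η j c (SC_an N0 hu hc j))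

theorem WSC_bd {N0 : ℕ} {c y : ℕ →ᵇ ℂ} {u : ℕ → ℝ} (hu : ∀ j, 0 ≤ u j)
    (hc : ∀ j, c j = u j) {r : ℝ} (hy : y ∈ ball c r) (j : ℕ) :
    ‖WSC N0 y j‖ ≤ Real.exp (-(lsc N0 j * (cth j - 2 * r))) := by
  have h1 : ‖y j - u j‖ ≤ r := by
    rw [← hc, ← dist_eq_norm]
    exact (BoundedContinuousFunction.dist_coe_le_dist j).trans (mem_ball.1 hy).le
  have h2 : ‖y j‖ ≤ u j + r := by
    have := norm_le_norm_add_norm_sub' (y j) (u j)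
    rw [Complex.norm_real, Real.norm_of_nonneg (hu j)] at this; linarith
  have h3 : u j - r ≤ (y j).re := by
    have := (abs_le.1 ((Complex.abs_re_le_norm _).trans h1)).1
    rw [Complex.sub_re, Complex.ofReal_re] at this; linarith
  unfold WSC
  have h4 := norm_EC_le (Nsc N0 j) (y j)
  rw [norm_mul]
  have h5 : ‖Complex.exp (-(lsc N0 j * cth j))‖ = Real.exp (-(lsc N0 j * cth j)) := by
    rw [Complex.norm_exp]; congr 1
    rw [Complex.neg_re, Complex.re_ofReal_mul, Complex.ofReal_re]
  rw [h5]
  refine (mul_le_mul_of_nonneg_left h4 (Real.exp_pos _).le).trans ?_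
  rw [← Real.exp_add, Real.exp_le_exp]
  have h6 : (Nsc N0 j : ℝ) = lsc N0 j := rfl
  have h7 : 0 ≤ lsc N0 j := by unfold lsc; positivity
  rw [h6]
  nlinarith

theorem WTC_bd {N0 : ℕ} {f : ℕ → ℝ} {η M Fx : ℝ} {c y : ℕ →ᵇ ℂ} {u : ℕ → ℝ}
    (hf : ∀ j, |f j| ≤ M) (hη : 0 < η) (hη1 : η ≤ 1)
    (hg : GoodPt f η M u Fx) (hc : ∀ j, c j = u j) {r : ℝ} (hr : r ≤ η / 2) (hy : y ∈ ball c r) (j : ℕ)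
    (hS : (SC N0 y j).re ≤ 1/4) :
    ‖WTC N0 f η y j‖ ≤ Real.exp (-(lsc N0 j * ((Fx + η / 4) + 3 * (η / 16)))) := by
  have hu := hg.nonneg
  have hM : 0 ≤ M := (abs_nonneg _).trans hg.bd
  have hF := abs_le.1 hg.bd
  have h1 : ‖y j - u j‖ ≤ r := by
    rw [← hc, ← dist_eq_norm]
    exact (BoundedContinuousFunction.dist_coe_le_dist j).trans (mem_ball.1 hy).le
  have h2 : ‖y j‖ ≤ u j + r := by
    have := norm_le_norm_add_norm_sub' (y j) (u j)
    rw [Complex.norm_real, Real.norm_of_nonneg (hu j)] at this; linarith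
  have h3 : u j - r ≤ (y j).re := by
    have := (abs_le.1 ((Complex.abs_re_le_norm _).trans h1)).1
    rw [Complex.sub_re, Complex.ofReal_re] at this; linarith
  have hre : (y j / 8).re = (y j).re / 8 := by
    have : (8:ℂ) = ((8:ℝ):ℂ) := by norm_num
    rw [this, Complex.div_ofReal_re]
  have hno : ‖y j / 8‖ = ‖y j‖ / 8 := by rw [norm_div]; norm_num
  have h6 : (Nsc N0 j : ℝ) = lsc N0 j := rfl
  have h7 : 0 ≤ lsc N0 j := by unfold lsc; positivity
  have hS' : η * (3/4) ≤ η * (1 - (SC N0 y j).re) := by gcongr; linarith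
  unfold WTC
  rw [norm_mul]
  have h5 : ‖Complex.exp (-(lsc N0 j * (f j + η * (1 - SC N0 y j))))‖ =
      Real.exp (-(lsc N0 j * (f j + η * (1 - (SC N0 y j).re)))) := by
    rw [Complex.norm_exp]; congr 1
    rw [Complex.neg_re, Complex.re_ofReal_mul, Complex.add_re, Complex.ofReal_re,
      Complex.re_ofReal_mul, Complex.sub_re, Complex.one_re]
  rw [h5]
  by_cases hcase : u j ≤ 16 * (2 * M + 3)
  · have h8 := (abs_le.1 (hg.near j hcase)).1
    have h4 := norm_EC_le (Nsc N0 j) (y j / 8)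
    refine (mul_le_mul_of_nonneg_left h4 (Real.exp_pos _).le).trans ?_
    rw [← Real.exp_add, Real.exp_le_exp, hre, hno, h6, ← neg_add, neg_le_neg_iff, ← mul_add]
    refine mul_le_mul_of_nonneg_left ?_ h7
    linarith
  · have h4 := norm_EC_le' (Nsc N0 j) (y j / 8)
    have h8 := (abs_le.1 (hf j)).1
    push Not at hcase
    refine (mul_le_mul_of_nonneg_left h4 (Real.exp_pos _).le).trans ?_
    rw [← Real.exp_add, Real.exp_le_exp, hre, hno, h6, ← neg_add, neg_le_neg_iff, ← mul_add]
    refine mul_le_mul_of_nonneg_left ?_ h7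
    linarith

/-- ball where an analytic function is analytic with controlled real part -/
theorem an_ball {E : Type*} [NormedAddCommGroup E] [NormedSpace ℂ E] {g : E → ℂ} {c : E} {b : ℝ}
    (h : AnalyticAt ℂ g c) (hb : (g c).re < b) :
    ∀ᶠ r in 𝓝[>] (0:ℝ), AnalyticOnNhd ℂ g (ball c r) ∧ ∀ y ∈ ball c r, (g y).re ≤ b := by
  have h1 : ∀ᶠ y in 𝓝 c, AnalyticAt ℂ g y ∧ (g y).re ≤ b := by
    refine h.eventually_analyticAt.and ?_
    have : ContinuousAt (fun y => (g y).re) c := Complex.continuous_re.continuousAt.comp h.continuousAt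
    exact (this.eventually (gt_mem_nhds hb)).mono fun y hy => hy.le
  obtain ⟨δ, hδ, hball⟩ := Metric.eventually_nhds_iff_ball.1 h1
  filter_upwards [Ioo_mem_nhdsGT hδ] with r hr
  exact ⟨fun y hy => (hball y (ball_subset_ball hr.2.le hy)).1,
    fun y hy => (hball y (ball_subset_ball hr.2.le hy)).2⟩

theorem Tlim_analytic {N0 : ℕ} (hN0 : 16 ≤ N0) {f : ℕ → ℝ} {η M Fx : ℝ} {c : ℕ →ᵇ ℂ} {u : ℕ → ℝ}
    (hf : ∀ j, |f j| ≤ M) (hη : 0 < η) (hη1 : η ≤ 1) (hN : 2 / (N0:ℝ) ≤ η / 16)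
    (hg : GoodPt f η M u Fx) (hc : ∀ j, c j = u j) :
    AnalyticAt ℂ (fun y : ℕ →ᵇ ℂ => limUnder atTop (fun n => TC N0 f η M y n)) c := by
  have h0 : 0 < N0 := by omega
  have hl := lsc_pos h0
  have hu := hg.nonneg
  obtain ⟨n', hn'⟩ := hg.cover
  set γ : ℝ := (1/2)^n'/80 with hγ
  have hγ0 : 0 < γ := by positivity
  set t0 : ℝ := cth (n'+1) - 5 * γ with ht0
  have hev : ∀ a > 0, ∀ᶠ n in atTop, Real.exp (-(lsc N0 n * a)) ≤ 1/2 := by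
    intro a ha
    have h1 : Tendsto (fun n => -(lsc N0 n * a)) atTop atBot :=
      tendsto_neg_atTop_atBot.comp ((lsc_tendsto h0).atTop_mul_const ha)
    have := (Real.tendsto_exp_atBot.comp h1).eventually (gt_mem_nhds (by norm_num : (0:ℝ) < 1/2))
    exact this.mono fun n hn => hn.le
  have hev2 : ∀ a > 0, ∀ᶠ n in atTop, 2 / lsc N0 n ≤ a := by
    intro a ha
    have : Tendsto (fun n => 2 / lsc N0 n) atTop (𝓝 0) := (lsc_tendsto h0).const_div_atTop 2
    exact (this.eventually (gt_mem_nhds ha)).mono fun n hn => hn.le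
  have hη16 : 0 < η / 16 := by positivity
  obtain ⟨n0, hn0⟩ := (((hev γ hγ0).and (hev _ hη16)).and ((hev2 γ hγ0).and (hev2 _ hη16))).exists_forall_of_atTop
  set n1 := max n0 (n'+1) with hn1
  have hn1' : n' + 1 ≤ n1 := le_max_right _ _
  have hn1n : ∀ n, n1 ≤ n → n0 ≤ n := fun n hn => (le_max_left _ _).trans hn
  have hSr : (SC N0 c n1).re < t0 + γ := by
    rw [SC_ofReal N0 hu hc, Complex.ofReal_re]
    have h1 := SR_le hN0 hu n' hn'
    have h2 := SR_anti h0 hu hn1'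
    have : t0 = cth (n'+1) - (1/2)^n'/16 := by rw [ht0, hγ]; ring
    linarith
  have hTr : (TC N0 f η M c n1).re < (Fx + η/4) + η/16 := by
    rw [TC_ofReal N0 f η M hu hc, Complex.ofReal_re]
    have := TR_le hN0 hη hη1 hN hg n' hn' n1 hn1'
    linarith
  obtain ⟨r, ⟨⟨hS1, hS2⟩, hT1, hT2⟩, hr0, hr⟩ :=
    (((an_ball (SC_an N0 hu hc n1) hSr).and (an_ball (TC_an N0 f η M hu hc n1) hTr)).and
      (Ioo_mem_nhdsGT (lt_min hγ0 (by positivity : 0 < η/2)))).exists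
  have hrγ : r ≤ γ := (hr.trans_le (min_le_left _ _)).le
  have hrη : r ≤ η / 2 := (hr.trans_le (min_le_right _ _)).le
  have tailS : ∀ n, n1 ≤ n → AnalyticOnNhd ℂ (fun y : ℕ →ᵇ ℂ => SC N0 y n) (ball c r) ∧
      ∀ y ∈ ball c r, (SC N0 y n).re ≤ 1/4 := by
    intro n hn
    have hsum : ∀ n, ∑ j ∈ Ico n1 n, 1 / lsc N0 j ≤ γ := fun n =>
      (lsc_sum h0 n1 n).trans (hn0 n1 (hn1n n1 le_rfl)).2.1
    obtain ⟨a1, a2, -⟩ := itC_tail hl 1 (W := fun y : ℕ →ᵇ ℂ => WSC N0 y) (s := ball c r) (n0 := n1)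
      (t0 := t0) (γ := γ) hS1 hS2 (fun n hn => (hn0 n (hn1n n hn)).1.1) hsum n hn
      (fun k _ _ y _ => WSC_an N0 k y) (fun k hk _ y hy => by
        refine (WSC_bd hu hc hy k).trans ?_
        rw [Real.exp_le_exp, neg_le_neg_iff]
        have := cth_mono (hn1'.trans hk)
        have := hl k
        gcongr
        linarith)
    refine ⟨a1, fun y hy => (a2 y hy).trans ?_⟩
    have := hsum n
    have := cth_le (n'+1)
    linarith
  have tailT : ∀ n, n1 ≤ n → _ := fun n hn => 
    itC_tail hl (M+1) (W := fun y : ℕ →ᵇ ℂ => WTC N0 f η y) (s := ball c r) (n0 := n1)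
      (t0 := Fx + η/4) (γ := η/16) hT1 hT2 (fun n hn => (hn0 n (hn1n n hn)).1.2)
      (fun n => (lsc_sum h0 n1 n).trans (hn0 n1 (hn1n n1 le_rfl)).2.2) n hn
      (fun k hk _ y hy => WTC_an N0 f η k y ((tailS k hk).1 y hy))
      (fun k hk _ y hy => WTC_bd hf hη hη1 hg hc hrη hy k ((tailS k hk).2 y hy))
  refine analyticAt_lim (g := fun n (y : ℕ →ᵇ ℂ) => TC N0 f η M y n) (a := fun k => 1 / lsc N0 k) hr0 n1 
    (fun k hk => (tailT k hk).1)
    (fun k hk y hy => (tailT (k+1) (hk.trans k.le_succ)).2.2 k hk k.lt_succ_self y hy) ?_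
  exact summable_of_sum_range_le (fun k => (one_div_pos.2 (hl k)).le) (lsc_sum' h0)

noncomputable def Tlim (N0 : ℕ) (f : ℕ → ℝ) (η M : ℝ) (y : ℕ →ᵇ ℂ) : ℂ :=
  limUnder atTop (fun n => TC N0 f η M y n)

theorem Tlim_tendsto {N0 : ℕ} (hN0 : 16 ≤ N0) {f : ℕ → ℝ} {η M Fx : ℝ} {c : ℕ →ᵇ ℂ} {u : ℕ → ℝ}
    (hf : ∀ j, |f j| ≤ M) (hη : 0 < η) (hN : 2 / (N0:ℝ) ≤ η / 16)
    (hg : GoodPt f η M u Fx) (hc : ∀ j, c j = u j) :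
    Tendsto (TR N0 f η M u) atTop (𝓝 (Tlim N0 f η M c).re) := by
  have h0 : 0 < N0 := by omega
  have h1 := tendsto_atTop_ciInf (TR_anti h0 f η M hg.nonneg)
    ⟨Fx - η/4, by rintro _ ⟨n, rfl⟩; exact TR_ge hN0 hf hη hN hg n⟩
  have h2 : Tendsto (fun n => TC N0 f η M c n) atTop (𝓝 ((⨅ i, TR N0 f η M u i : ℝ) : ℂ)) := by
    have : (fun n => TC N0 f η M c n) = fun n => ((TR N0 f η M u n : ℝ) : ℂ) := by
      ext n; exact TC_ofReal N0 f η M hg.nonneg hc n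
    rw [this]
    exact (Complex.continuous_ofReal.tendsto _).comp h1
  rw [Tlim, h2.limUnder_eq, Complex.ofReal_re]
  exact h1

theorem Tlim_near {N0 : ℕ} (hN0 : 16 ≤ N0) {f : ℕ → ℝ} {η M Fx : ℝ} {c : ℕ →ᵇ ℂ} {u : ℕ → ℝ}
    (hf : ∀ j, |f j| ≤ M) (hη : 0 < η) (hη1 : η ≤ 1) (hN : 2 / (N0:ℝ) ≤ η / 16)
    (hg : GoodPt f η M u Fx) (hc : ∀ j, c j = u j) :
    |Fx - (Tlim N0 f η M c).re| < η := by
  have h := Tlim_tendsto hN0 hf hη hN hg hc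
  have h1 := ge_of_tendsto' h (TR_ge hN0 hf hη hN hg)
  obtain ⟨n', hn'⟩ := hg.cover
  have h2 := le_of_tendsto h ((eventually_gt_atTop n').mono fun m hm => TR_le hN0 hη hη1 hN hg n' hn' m hm)
  rw [abs_lt]; constructor <;> linarith

theorem Tlim_lip {N0 : ℕ} (hN0 : 16 ≤ N0) {f : ℕ → ℝ} {η M Fx Fx' : ℝ} {c c' : ℕ →ᵇ ℂ} {u u' : ℕ → ℝ}
    (hf : ∀ j, |f j| ≤ M) (hη : 0 < η) (hN : 2 / (N0:ℝ) ≤ η / 16)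
    (hg : GoodPt f η M u Fx) (hc : ∀ j, c j = u j)
    (hg' : GoodPt f η M u' Fx') (hc' : ∀ j, c' j = u' j) {D : ℝ} (hD : ∀ j, |u j - u' j| ≤ D) :
    (Tlim N0 f η M c).re - (Tlim N0 f η M c').re ≤ (η + 1) * D := by
  have h := Tlim_tendsto hN0 hf hη hN hg hc
  have h' := Tlim_tendsto hN0 hf hη hN hg' hc'
  exact le_of_tendsto' (h.sub h') fun n => by
    have := TR_lip (by omega : 0 < N0) f hη M hg.nonneg hg'.nonneg hD n
    linarith

end partA

section partP
open Finset Filter Topology Metric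
open scoped BoundedContinuousFunction

variable {X : Type*} [NormedAddCommGroup X] [NormedSpace ℝ X]

/-- sum of squares of the homogeneous parts -/
noncomputable def psq (n : ℕ) (P : (i : ℕ) → ContinuousMultilinearMap ℝ (fun _ : Fin i => X) ℝ)
    (y : X) : ℝ := ∑ i ∈ range n, (P (i+1) (fun _ => y)) ^ 2

theorem psq_nonneg (n : ℕ) (P : (i : ℕ) → ContinuousMultilinearMap ℝ (fun _ : Fin i => X) ℝ)
    (y : X) : 0 ≤ psq n P y := sum_nonneg fun i _ => sq_nonneg _

theorem psq_zero (n : ℕ) (P : (i : ℕ) → ContinuousMultilinearMap ℝ (fun _ : Fin i => X) ℝ) :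
    psq n P 0 = 0 := by
  unfold psq
  refine sum_eq_zero fun i _ => ?_
  rw [(P (i+1)).map_coord_zero (0 : Fin (i+1)) rfl]; norm_num

theorem psq_lower {q : X → ℝ} {n : ℕ} {P : (i : ℕ) → ContinuousMultilinearMap ℝ (fun _ : Fin i => X) ℝ}
    (hq : ∀ x, q x = ∑ i ∈ range (n + 1), P i (fun _ => x)) (hq0 : q 0 = 0) {η : ℝ} (hη : 0 < η)
    (h : ∀ x : X, ‖x‖ = 1 → η ≤ |q x|) {ρ : ℝ} (hρ : 0 < ρ) (hρ1 : ρ ≤ 1) (y : X) (hy : ρ ≤ ‖y‖) :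
    ρ ^ (2 * n) * (η ^ 2 / (n + 1)) ≤ psq n P y := by
  have hP0 : ∀ x, P 0 (fun _ => x) = 0 := by
    intro x
    have h1 := hq 0
    rw [hq0, sum_range_succ', sum_eq_zero] at h1
    · rw [zero_add] at h1
      rw [h1]; congr 1; exact Subsingleton.elim _ _
    · intro i _
      exact (P (i+1)).map_coord_zero (0 : Fin (i+1)) rfl
  have hy0 : 0 < ‖y‖ := hρ.trans_le hy
  set z := ‖y‖⁻¹ • y with hz
  have hz1 : ‖z‖ = 1 := by rw [hz, norm_smul, norm_inv, norm_norm, inv_mul_cancel₀ hy0.ne']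
  have hyz : y = ‖y‖ • z := by rw [hz, smul_smul, mul_inv_cancel₀ hy0.ne', one_smul]
  have h1 : η ^ 2 ≤ n * psq n P z := by
    have h2 := h z hz1
    rw [hq, sum_range_succ', hP0, add_zero] at h2
    have h3 := sq_sum_le_card_mul_sum_sq (s := range n) (f := fun i => P (i+1) (fun _ => z))
    rw [card_range] at h3
    refine le_trans ?_ h3
    rw [← sq_abs (∑ i ∈ range n, _)]
    gcongr
  have h2 : η ^ 2 / (n + 1) ≤ psq n P z := by
    rw [div_le_iff₀ (by positivity)]
    have := psq_nonneg n P z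
    linarith
  have h3 : ρ ^ (2 * n) * psq n P z ≤ psq n P y := by
    unfold psq
    rw [mul_sum]
    refine sum_le_sum fun i hi => ?_
    have hi' : i + 1 ≤ n := mem_range.1 hi
    have e : P (i+1) (fun _ => y) = ‖y‖ ^ (i+1) * P (i+1) (fun _ => z) := by
      conv_lhs => rw [hyz]
      rw [(P (i+1)).map_smul_univ (fun _ => ‖y‖) (fun _ => z)]
      simp
    rw [e, mul_pow, ← pow_mul, mul_comm (i+1) 2]
    gcongr
    calc ρ ^ (2 * n) ≤ ρ ^ (2 * (i+1)) := pow_le_pow_of_le_one hρ.le hρ1 (by omega)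
      _ ≤ _ := by gcongr
  refine le_trans ?_ h3
  gcongr

theorem psq_lip (n : ℕ) (P : (i : ℕ) → ContinuousMultilinearMap ℝ (fun _ : Fin i => X) ℝ)
    {B : ℝ} (hB : 0 ≤ B) : ∃ C : ℝ, 0 ≤ C ∧ ∀ y z : X, ‖y‖ ≤ B → ‖z‖ ≤ B →
      |psq n P y - psq n P z| ≤ C * ‖y - z‖ := by
  refine ⟨∑ i ∈ range n, (‖P (i+1)‖ * ((i+1 : ℕ):ℝ) * B ^ i) * (2 * (‖P (i+1)‖ * B ^ (i+1))), 
    by positivity, fun y z hy hz => ?_⟩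
  unfold psq
  rw [← sum_sub_distrib, sum_mul]
  refine (abs_sum_le_sum_abs _ _).trans (sum_le_sum fun i _ => ?_)
  have hb : ∀ w : X, ‖w‖ ≤ B → |P (i+1) (fun _ => w)| ≤ ‖P (i+1)‖ * B ^ (i+1) := by
    intro w hw
    have := (P (i+1)).le_opNorm (fun _ => w)
    rw [Real.norm_eq_abs] at this
    refine this.trans ?_
    simp only [prod_const, card_univ, Fintype.card_fin]
    gcongr
  have h1 := (P (i+1)).norm_image_sub_le (fun _ => y) (fun _ => z)
  have hn : ∀ w : X, ‖(fun _ : Fin (i+1) => w)‖ = ‖w‖ := fun w => pi_norm_const w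
  have hs : (fun _ : Fin (i+1) => y) - (fun _ => z) = fun _ => y - z := rfl
  rw [hs, hn, hn, hn, Fintype.card_fin, Nat.add_sub_cancel, Real.norm_eq_abs] at h1
  have h2 : |P (i+1) (fun _ => y) - P (i+1) (fun _ => z)| ≤ 
      ‖P (i+1)‖ * ((i+1 : ℕ):ℝ) * B ^ i * ‖y - z‖ := by
    refine h1.trans ?_
    gcongr
    exact max_le hy hz
  have h3 : |P (i+1) (fun _ => y) + P (i+1) (fun _ => z)| ≤ 2 * (‖P (i+1)‖ * B ^ (i+1)) :=
    (abs_add_le _ _).trans (by linarith [hb y hy, hb z hz])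
  rw [sq_sub_sq, mul_comm, abs_mul]
  calc _ ≤ (‖P (i+1)‖ * ((i+1 : ℕ):ℝ) * B ^ i * ‖y - z‖) * (2 * (‖P (i+1)‖ * B ^ (i+1))) := by
        gcongr
    _ = _ := by ring

theorem seqMul_bd {i : ℕ} (p : ContinuousMultilinearMap ℝ (fun _ : Fin i => X) ℝ)
    (m : Fin i → (ℕ →ᵇ X)) (j : ℕ) : ‖((p (fun k => m k j) : ℝ) : ℂ)‖ ≤ ‖p‖ * ∏ k, ‖m k‖ := by
  rw [Complex.norm_real]
  refine (p.le_opNorm _).trans ?_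
  gcongr with k _
  exact (m k).norm_coe_le_norm j

/-- pointwise action of a multilinear form on bounded sequences -/
noncomputable def seqMul {i : ℕ} (p : ContinuousMultilinearMap ℝ (fun _ : Fin i => X) ℝ) :
    ContinuousMultilinearMap ℝ (fun _ : Fin i => ℕ →ᵇ X) (ℕ →ᵇ ℂ) :=
  MultilinearMap.mkContinuous
    { toFun := fun m => BoundedContinuousFunction.ofNormedAddCommGroup
        (fun j => ((p (fun k => m k j) : ℝ) : ℂ)) continuous_of_discreteTopology (‖p‖ * ∏ k, ‖m k‖)
        (seqMul_bd p m)
      map_update_add' := by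
        intro _ m k x y
        ext j
        have e : ∀ x : ℕ →ᵇ X, (fun k' => (Function.update m k x) k' j)
            = Function.update (fun k' => m k' j) k (x j) := by
          intro x; ext k'
          by_cases h : k' = k
          · subst h; simp
          · simp [h]
        simp [e]
      map_update_smul' := by
        intro _ m k c x
        ext j
        have e : ∀ x : ℕ →ᵇ X, (fun k' => (Function.update m k x) k' j)
            = Function.update (fun k' => m k' j) k (x j) := by
          intro x; ext k'
          by_cases h : k' = k
          · subst h; simp
          · simp [h]
        simp [e] }
    ‖p‖ (fun m => BoundedContinuousFunction.norm_ofNormedAddCommGroup_le _ (by positivity) (seqMul_bd p m))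

theorem seqMul_apply {i : ℕ} (p : ContinuousMultilinearMap ℝ (fun _ : Fin i => X) ℝ)
    (m : Fin i → (ℕ →ᵇ X)) (j : ℕ) : seqMul p m j = ((p (fun k => m k j) : ℝ) : ℂ) := rfl

noncomputable def constL : X →L[ℝ] (ℕ →ᵇ X) :=
  LinearMap.mkContinuous
    { toFun := fun x => BoundedContinuousFunction.const ℕ x
      map_add' := fun x y => by ext j; simp
      map_smul' := fun c y => by ext j; simp } 1 
    (fun x => by rw [one_mul]; exact BoundedContinuousFunction.norm_const_le x)

noncomputable def Useq (n : ℕ) (P : (i : ℕ) → ContinuousMultilinearMap ℝ (fun _ : Fin i => X) ℝ)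
    (A : ℝ) (b : ℕ →ᵇ X) (x : X) : ℕ →ᵇ ℂ :=
  A • ∑ i ∈ range n, (seqMul (P (i+1)) (fun _ => constL x - b)) ^ 2

theorem Useq_apply (n : ℕ) (P : (i : ℕ) → ContinuousMultilinearMap ℝ (fun _ : Fin i => X) ℝ)
    (A : ℝ) (b : ℕ →ᵇ X) (x : X) (j : ℕ) : 
    Useq n P A b x j = ((A * psq n P (x - b j) : ℝ) : ℂ) := by
  unfold Useq psq
  have : ∀ j, (constL x - b) j = x - b j := fun j => rfl
  simp [seqMul_apply, this]

theorem Useq_an (n : ℕ) (P : (i : ℕ) → ContinuousMultilinearMap ℝ (fun _ : Fin i => X) ℝ)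
    (A : ℝ) (b : ℕ →ᵇ X) (x : X) : AnalyticAt ℝ (Useq n P A b) x := by
  unfold Useq
  refine AnalyticAt.fun_const_smul ?_
  refine Finset.analyticAt_fun_sum _ fun i _ => ?_
  refine AnalyticAt.fun_pow ?_ 2
  have h1 : AnalyticAt ℝ (fun x : X => (fun _ : Fin (i+1) => constL x - b)) x := by
    refine AnalyticAt.pi fun k => ?_
    exact (constL.analyticAt x).sub analyticAt_const
  exact AnalyticAt.fun_comp ((seqMul (P (i+1))).analyticAt) h1

end partP

/-- Main theorem: on a separable real Banach space admitting a separating polynomial,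
any bounded uniformly continuous function on a bounded open set `G` can be uniformly
approximated on `G` by functions which are real analytic and Lipschitz on `G`. -/
theorem lipschitz_analytic_approximation
    {X : Type*} [NormedAddCommGroup X] [NormedSpace ℝ X] [CompleteSpace X]
    [TopologicalSpace.SeparableSpace X]
    (hsep : ∃ q : X → ℝ, IsSeparatingPolynomial q)
    (G : Set X) (hGopen : IsOpen G) (hGbdd : Bornology.IsBounded G)
    (F : X → ℝ) (hFbdd : ∃ M : ℝ, ∀ x ∈ G, |F x| ≤ M)
    (hFuc : UniformContinuousOn F G)
    (ε : ℝ) (hε : 0 < ε) :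
    ∃ K : X → ℝ, AnalyticOnNhd ℝ K G ∧ (∃ L : ℝ≥0, LipschitzOnWith L K G) ∧
      ∀ x ∈ G, |F x - K x| < ε := by
  rcases G.eq_empty_or_nonempty with rfl | hne
  · exact ⟨0, fun x hx => hx.elim, ⟨0, by simp⟩, fun x hx => hx.elim⟩
  obtain ⟨q, ⟨n, P, hq⟩, hq0, η₀, hη₀, hlow⟩ := hsep
  obtain ⟨M, hM⟩ := hFbdd
  have hM0 : 0 ≤ M := by
    obtain ⟨x, hx⟩ := hne
    exact (abs_nonneg _).trans (hM x hx)
  set η : ℝ := min ε 1 with hηdef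
  have hη : 0 < η := lt_min hε one_pos
  have hη1 : η ≤ 1 := min_le_right _ _
  have hηε : η ≤ ε := min_le_left _ _
  obtain ⟨δ, hδ, hFδ⟩ := Metric.uniformContinuousOn_iff.1 hFuc (η / 8) (by positivity)
  set ρ : ℝ := min δ 1 with hρdef
  have hρ : 0 < ρ := lt_min hδ one_pos
  have hρ1 : ρ ≤ 1 := min_le_right _ _
  obtain ⟨B, hB0, hB⟩ := hGbdd.exists_pos_norm_le
  have : Nonempty G := hne.to_subtype
  have : SecondCountableTopology X := UniformSpace.secondCountable_of_separable X
  set xs : ℕ → G := TopologicalSpace.denseSeq G with hxs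
  set b : BoundedContinuousFunction ℕ X := BoundedContinuousFunction.ofNormedAddCommGroup
    (fun j => (xs j : X)) continuous_of_discreteTopology B (fun j => hB _ (xs j).2) with hb
  have hbj : ∀ j, b j = xs j := fun j => rfl
  obtain ⟨C, hC0, hC⟩ := psq_lip n P (B := 2 * B) (by positivity)
  have hdiff : ∀ x ∈ G, ∀ j, ‖x - b j‖ ≤ 2 * B := fun x hx j => by
    have h1 := norm_sub_le x (b j)
    have h2 := hB x hx
    have h3 := hB _ (xs j).2
    rw [hbj] at *
    linarith
  set β : ℝ := ρ ^ (2 * n) * (η₀ ^ 2 / (n + 1)) with hβ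
  have hβ0 : 0 < β := by positivity
  set A : ℝ := (16 * (2 * M + 3) + 1) / β with hA
  have hA0 : 0 < A := by positivity
  set f : ℕ → ℝ := fun j => F (xs j) with hf
  have hfM : ∀ j, |f j| ≤ M := fun j => hM _ (xs j).2
  obtain ⟨N1, hN1⟩ := exists_nat_ge (32 / η)
  set N0 := max 16 N1 with hN0
  have h16 : 16 ≤ N0 := le_max_left _ _
  have hN : 2 / (N0:ℝ) ≤ η / 16 := by
    have h1 : 32 / η ≤ (N0 : ℝ) := hN1.trans (by exact_mod_cast le_max_right _ _)
    have h2 : (0:ℝ) < N0 := by positivity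
    rw [div_le_iff₀ hη] at h1
    rw [div_le_iff₀ h2]
    linarith
  have good : ∀ x ∈ G, GoodPt f η M (fun j => A * psq n P (x - b j)) (F x) := by
    intro x hx
    refine ⟨fun j => mul_nonneg hA0.le (psq_nonneg _ _ _), fun j hj => ?_, ?_, hM x hx⟩
    · have h1 : ‖x - b j‖ < ρ := by
        by_contra hcon
        push Not at hcon
        have h2 := psq_lower hq hq0 hη₀ hlow hρ hρ1 _ hcon
        have h3 : A * β ≤ A * psq n P (x - b j) := by gcongr
        have h4 : A * β = 16 * (2 * M + 3) + 1 := by rw [hA]; field_simp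
        linarith
      have h2 := hFδ (xs j) (xs j).2 x hx (by
        rw [dist_comm, dist_eq_norm]
        exact h1.trans_le (min_le_left _ _))
      rw [Real.dist_eq] at h2
      exact h2.le
    · have hpos : 0 < 1 / (2 * (A * C + 1)) := by positivity
      obtain ⟨j, hj⟩ := (TopologicalSpace.denseRange_denseSeq G).exists_dist_lt ⟨x, hx⟩ hpos
      refine ⟨j, ?_⟩
      have h1 : ‖x - b j‖ < 1 / (2 * (A * C + 1)) := by
        rw [← dist_eq_norm]; exact hj
      have h2 := hC (x - b j) 0 (hdiff x hx j) (by rw [norm_zero]; positivity)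
      rw [psq_zero, sub_zero, sub_zero, abs_of_nonneg (psq_nonneg _ _ _)] at h2
      rw [lt_div_iff₀ (by positivity)] at h1
      have h3 : A * psq n P (x - b j) ≤ A * (C * ‖x - b j‖) := by gcongr
      have := norm_nonneg (x - b j)
      nlinarith
  have hval : ∀ x j, Useq n P A b x j = ((A * psq n P (x - b j) : ℝ) : ℂ) := Useq_apply n P A b
  have lip1 : ∀ x ∈ G, ∀ y ∈ G, (Tlim N0 f η M (Useq n P A b x)).re -
      (Tlim N0 f η M (Useq n P A b y)).re ≤ (η + 1) * (A * C * ‖x - y‖) := by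
    intro x hx y hy
    refine Tlim_lip h16 hfM hη hN (good x hx) (hval x) (good y hy) (hval y) fun j => ?_
    rw [← mul_sub, abs_mul, abs_of_pos hA0, mul_assoc]
    have := hC _ _ (hdiff x hx j) (hdiff y hy j)
    rw [sub_sub_sub_cancel_right] at this
    gcongr
  refine ⟨fun x => (Tlim N0 f η M (Useq n P A b x)).re, ?_, ?_, ?_⟩
  · intro x hx
    have h1 := Tlim_analytic h16 hfM hη hη1 hN (good x hx) (hval x)
    have h2 : AnalyticAt ℝ (Tlim N0 f η M) (Useq n P A b x) := h1.restrictScalars (𝕜 := ℝ)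
    have h3 : AnalyticAt ℝ (fun x => Tlim N0 f η M (Useq n P A b x)) x :=
      AnalyticAt.fun_comp h2 (Useq_an n P A b x)
    exact AnalyticAt.fun_comp (Complex.reCLM.analyticAt _) h3
  · refine ⟨Real.toNNReal ((η + 1) * (A * C)), LipschitzOnWith.of_dist_le_mul fun x hx y hy => ?_⟩
    rw [Real.dist_eq, dist_eq_norm, Real.coe_toNNReal _ (by positivity), mul_assoc, abs_le]
    have h1 := lip1 x hx y hy
    have h2 := lip1 y hy x hx
    rw [norm_sub_rev] at h2
    constructor <;> linarith
  · intro x hx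
    exact (Tlim_near h16 hfM hη hη1 hN (good x hx) (hval x)).trans_le hηε
end

section
/- Let X be a real Banach space and suppose that for every ε > 0 there is a function f : X → ℝ, real analytic on X, with |f(x) − ‖x‖_X| < ε for all x ∈ X (i.e., the norm of X can be uniformly approximated on X by analytic functions). Then X admits a C^∞-smooth bump function: a C^∞-smooth function b : X → ℝ which is not identically zero and has bounded support. -/
/-- If the norm of a real Banach space `X` can be uniformly approximated on `X` by real
analytic functions, then `X` admits a `C^∞`-smooth bump function. -/
theorem smooth_bump_of_analytic_approx_norm
    {X : Type*} [NormedAddCommGroup X] [NormedSpace ℝ X] [CompleteSpace X]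
    (h : ∀ ε > (0 : ℝ), ∃ f : X → ℝ, AnalyticOnNhd ℝ f Set.univ ∧ ∀ x : X, |f x - ‖x‖| < ε) :
    ∃ b : X → ℝ, ContDiff ℝ (⊤ : ℕ∞) b ∧ (∃ x, b x ≠ 0) ∧
      Bornology.IsBounded (Function.support b) := by
  obtain ⟨f, hf, hε⟩ := h 1 one_pos
  refine ⟨fun x => Real.smoothTransition (2 - f x), ?_, ⟨0, ?_⟩, ?_⟩
  · have hfc : ContDiff ℝ (⊤ : ℕ∞) f := contDiff_iff_contDiffAt.2 fun x =>
      (hf x (Set.mem_univ x)).contDiffAt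
    exact Real.smoothTransition.contDiff.comp (contDiff_const.sub hfc)
  · have h0 := abs_lt.1 (hε 0)
    rw [norm_zero] at h0
    exact (Real.smoothTransition.pos_of_pos (by linarith [h0.2])).ne'
  · refine Metric.isBounded_ball (x := (0 : X)) (r := 3) |>.subset ?_
    intro x hx
    rw [mem_ball_zero_iff]
    by_contra hlt
    apply hx
    have hx1 := abs_lt.1 (hε x)
    exact Real.smoothTransition.zero_of_nonpos (by linarith [hx1.1, not_lt.1 hlt])
end
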